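/- Let H ∈ 𝔽₂^{8×15} be the parity-check matrix with rows (1,0,1,1,1,0,0,1,1,0,0,0,0,0,0), (0,1,1,0,1,0,0,0,1,0,0,0,0,0,0), (0,0,1,1,0,1,0,0,0,1,0,0,0,0,0), (0,0,0,1,1,0,1,0,0,0,1,0,0,0,0), (0,0,0,0,1,1,0,1,0,0,0,1,0,0,0), (0,0,0,0,0,1,1,0,1,0,0,0,1,0,0), (0,0,0,0,0,0,1,1,0,1,0,0,0,1,0), (0,0,0,0,0,0,0,1,1,0,1,0,0,0,1). Then every matrix H' ∈ 𝔽₂^{8×15} with {y ∈ 𝔽₂¹⁵ : H'·y = 0} = {y ∈ 𝔽₂¹⁵ : H·y = 0} has at least 32 entries equal to 1; that is, the minimal number of ones of any parity-check matrix of this code equals is bounded below by 32. -/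

import Mathlib

/-- If `H` has a right inverse `B`, a matrix `H'` of the same shape with the same kernel
has its rows among the nonzero elements of the row space of `H`. -/
theorem exists_row_eq_vecMul_of_ker_eq {K m n : Type*} [Field K] [Fintype m] [DecidableEq m]
    [Fintype n] {H H' : Matrix m n K} {B : Matrix n m K} (hB : H * B = 1)
    (hker : ∀ y, H'.mulVec y = 0 ↔ H.mulVec y = 0) (i : m) :
    ∃ c : m → K, c ≠ 0 ∧ H' i = Matrix.vecMul c H := by
  have hfactor : H' = H' * B * H := by
    refine Matrix.mulVec_injective (funext fun y => ?_)
    have hy : H.mulVec (y - B.mulVec (H.mulVec y)) = 0 := by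
      rw [Matrix.mulVec_sub, Matrix.mulVec_mulVec, hB, Matrix.one_mulVec, sub_self]
    have hy' := (hker _).2 hy
    rw [Matrix.mulVec_sub, sub_eq_zero] at hy'
    simpa only [Matrix.mulVec_mulVec, Matrix.mul_assoc] using hy'
  have hinj : Function.Injective (H' * B).mulVec := by
    refine (injective_iff_map_eq_zero (H' * B).mulVecLin).2 fun z hz => ?_
    rw [Matrix.mulVecLin_apply, ← Matrix.mulVec_mulVec] at hz
    have hz' := (hker _).1 hz
    rwa [Matrix.mulVec_mulVec, hB, Matrix.one_mulVec] at hz'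
  have hunit := Matrix.mulVec_injective_iff_isUnit.1 hinj
  refine ⟨(H' * B) i, fun h0 => ?_, ?_⟩
  · have hdet := (Matrix.isUnit_iff_isUnit_det _).1 hunit
    exact hdet.ne_zero (Matrix.det_eq_zero_of_row_eq_zero i fun j => congrFun h0 j)
  · exact congrFun hfactor i

/-- The double-error-correcting BCH code of length 15 and dimension 7: a parity-check matrix. -/
def bchParityCheck : Matrix (Fin 8) (Fin 15) (ZMod 2) :=
  !![1,0,1,1,1,0,0,1,1,0,0,0,0,0,0;
    0,1,1,0,1,0,0,0,1,0,0,0,0,0,0;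
    0,0,1,1,0,1,0,0,0,1,0,0,0,0,0;
    0,0,0,1,1,0,1,0,0,0,1,0,0,0,0;
    0,0,0,0,1,1,0,1,0,0,0,1,0,0,0;
    0,0,0,0,0,1,1,0,1,0,0,0,1,0,0;
    0,0,0,0,0,0,1,1,0,1,0,0,0,1,0;
    0,0,0,0,0,0,0,1,1,0,1,0,0,0,1]

/-- A right inverse of `bchParityCheck`. -/
def bchRightInverse : Matrix (Fin 15) (Fin 8) (ZMod 2) :=
  !![1,0,1,0,1,0,0,0;
    0,1,1,1,0,1,0,0;
    0,0,1,1,1,0,1,0;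
    0,0,0,1,1,1,0,1;
    0,0,0,0,1,1,1,0;
    0,0,0,0,0,1,1,1;
    0,0,0,0,0,0,1,1;
    0,0,0,0,0,0,0,1;
    0,0,0,0,0,0,0,0;
    0,0,0,0,0,0,0,0;
    0,0,0,0,0,0,0,0;
    0,0,0,0,0,0,0,0;
    0,0,0,0,0,0,0,0;
    0,0,0,0,0,0,0,0;
    0,0,0,0,0,0,0,0]

theorem bchParityCheck_mul_bchRightInverse : bchParityCheck * bchRightInverse = 1 := by
  decide +kernel

/-- The dual of the BCH code has minimum distance at least 4. -/
theorem four_le_weight_vecMul_bchParityCheck : ∀ c : Fin 8 → ZMod 2, c ≠ 0 →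
    4 ≤ (Finset.univ.filter fun j => Matrix.vecMul c bchParityCheck j = 1).card := by
  decide +kernel

/-- Every parity-check matrix of the code of the explicit BCH(15,7) matrix `H` of
Equation (1) has at least 32 one-entries. -/
theorem bch_example_min_ones (H : Matrix (Fin 8) (Fin 15) (ZMod 2))
    (hH : H = !![1,0,1,1,1,0,0,1,1,0,0,0,0,0,0;
                 0,1,1,0,1,0,0,0,1,0,0,0,0,0,0;
                 0,0,1,1,0,1,0,0,0,1,0,0,0,0,0;
                 0,0,0,1,1,0,1,0,0,0,1,0,0,0,0;
                 0,0,0,0,1,1,0,1,0,0,0,1,0,0,0;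
                 0,0,0,0,0,1,1,0,1,0,0,0,1,0,0;
                 0,0,0,0,0,0,1,1,0,1,0,0,0,1,0;
                 0,0,0,0,0,0,0,1,1,0,1,0,0,0,1]) :
    ∀ H' : Matrix (Fin 8) (Fin 15) (ZMod 2),
      {y : Fin 15 → ZMod 2 | H'.mulVec y = 0} = {y : Fin 15 → ZMod 2 | H.mulVec y = 0} →
        32 ≤ (Finset.univ.filter (fun p : Fin 8 × Fin 15 => H' p.1 p.2 = 1)).card := by
  intro H' hker
  have hH : H = bchParityCheck := hH
  subst hH
  have hrow (i : Fin 8) : 4 ≤ (Finset.univ.filter fun j => H' i j = 1).card := by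
    obtain ⟨c, hc, hi⟩ := exists_row_eq_vecMul_of_ker_eq bchParityCheck_mul_bchRightInverse
      (fun y => Set.ext_iff.1 hker y) i
    rw [hi]
    exact four_le_weight_vecMul_bchParityCheck c hc
  calc
    32 = ∑ _i : Fin 8, 4 := by simp
    _ ≤ ∑ i, (Finset.univ.filter fun j => H' i j = 1).card :=
      Finset.sum_le_sum fun i _ => hrow i
    _ = _ := by simp only [Finset.card_filter, Fintype.sum_prod_type]
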